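/- Let φ : I → J be a morphism of doubly-pointed model diagrams admitting a section ψ : J → I (so φ ∘ ψ = id_J), and suppose there is a natural transformation between id_I and ψ ∘ φ (in either direction, or more generally a finite zigzag of natural transformations connecting them) all of whose components lie in W_I and whose components at s and t are identities. Then for every doubly-pointed model diagram E, the restriction functor φ* : Fun_{**}(J,E)^W → Fun_{**}(I,E)^W induces a simplicial homotopy equivalence N(Fun_{**}(J,E)^W) → N(Fun_{**}(I,E)^W), with homotopy inverse induced by ψ*; in particular this map of nerves is a weak homotopy equivalence. -/

import Mathlib

open CategoryTheory CategoryTheory.Limits Simplicial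

universe w v u

namespace Paper

/-- The map constant at vertex `i` of `Δ[1]`. -/
def constVertex (X : SSet.{w}) (i : Fin 2) : X ⟶ Δ[1] where
  app m := TypeCat.ofHom fun _ => ULift.up (SimplexCategory.const m.unop ⦋1⦌ i)
  naturality _ _ _ := by rfl

/-- Elementary simplicial homotopy between two maps of simplicial sets,
given by a map out of the cylinder `X ⨯ Δ[1]`. -/
def SHomotopy {X Y : SSet.{w}} (f g : X ⟶ Y) : Prop :=
  ∃ H : X ⨯ Δ[1] ⟶ Y,
    prod.lift (𝟙 X) (constVertex X 0) ≫ H = f ∧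
    prod.lift (𝟙 X) (constVertex X 1) ≫ H = g

/-- The relation of being simplicially homotopic: the equivalence relation
generated by elementary simplicial homotopies. -/
def Htpy {X Y : SSet.{w}} (f g : X ⟶ Y) : Prop := Relation.EqvGen SHomotopy f g

/-- Kan complexes, as `SSet.KanComplex` was defined in the older Mathlib: horn filling
for every `n : ℕ` (including `n = 0`) and `0 ≤ i ≤ n`. -/
class KanComplex (S : SSet.{w}) : Prop where
  hornFilling : ∀ ⦃n : ℕ⦄ ⦃i : Fin (n + 1)⦄ (σ₀ : (Λ[n, i] : SSet.{w}) ⟶ S),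
    ∃ σ : Δ[n] ⟶ S, σ₀ = Λ[n, i].ι ≫ σ

/-- A map of simplicial sets is a weak homotopy equivalence (in the Kan–Quillen sense)
iff for every Kan complex `K` the induced map on simplicial homotopy classes of maps
into `K` is a bijection. -/
def IsWeakHomotopyEquiv {X Y : SSet.{w}} (f : X ⟶ Y) : Prop :=
  ∀ (K : SSet.{w}), KanComplex K →
    (∀ g : X ⟶ K, ∃ h : Y ⟶ K, Htpy (f ≫ h) g) ∧
    (∀ h h' : Y ⟶ K, Htpy (f ≫ h) (f ≫ h') → Htpy h h')

/-- A simplicial set is weakly contractible if its map to the terminal object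
is a weak homotopy equivalence. -/
def WeaklyContractible (X : SSet.{w}) : Prop := IsWeakHomotopyEquiv (terminal.from X)

/-- The map on nerves induced by a functor. -/
def nerveMap {C : Type u} {D : Type u} [Category.{v} C] [Category.{v} D] (F : C ⥤ D) :
    nerve C ⟶ nerve D where
  app _ := TypeCat.ofHom fun G => G ⋙ F
  naturality _ _ _ := by rfl



/-- `f` is a retract of `g` in the arrow category. -/
def IsRetractOf {C : Type u} [Category.{v} C] {X Y X' Y' : C} (f : X ⟶ Y) (g : X' ⟶ Y') : Prop :=
  ∃ (i : X ⟶ X') (r : X' ⟶ X) (j : Y ⟶ Y') (s : Y' ⟶ Y),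
    i ≫ r = 𝟙 X ∧ j ≫ s = 𝟙 Y ∧ i ≫ g = f ≫ j ∧ r ≫ f = g ≫ s

/-- A (Quillen) model structure on a category: three wide subcategories of weak
equivalences, cofibrations and fibrations, satisfying the two-out-of-three, retract,
lifting and factorization axioms.  (No functorial factorizations are assumed; a model
category is a finitely bicomplete category equipped with such a structure.) -/
structure ModelStructure (C : Type u) [Category.{v} C] where
  W : MorphismProperty C
  Cof : MorphismProperty C
  Fib : MorphismProperty C
  W_id : ∀ X : C, W (𝟙 X)
  Cof_id : ∀ X : C, Cof (𝟙 X)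
  Fib_id : ∀ X : C, Fib (𝟙 X)
  W_comp : ∀ {X Y Z : C} (f : X ⟶ Y) (g : Y ⟶ Z), W f → W g → W (f ≫ g)
  Cof_comp : ∀ {X Y Z : C} (f : X ⟶ Y) (g : Y ⟶ Z), Cof f → Cof g → Cof (f ≫ g)
  Fib_comp : ∀ {X Y Z : C} (f : X ⟶ Y) (g : Y ⟶ Z), Fib f → Fib g → Fib (f ≫ g)
  W_of_precomp : ∀ {X Y Z : C} (f : X ⟶ Y) (g : Y ⟶ Z), W f → W (f ≫ g) → W g
  W_of_postcomp : ∀ {X Y Z : C} (f : X ⟶ Y) (g : Y ⟶ Z), W g → W (f ≫ g) → W f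
  W_retract : ∀ {X Y X' Y' : C} {f : X ⟶ Y} {g : X' ⟶ Y'}, IsRetractOf f g → W g → W f
  Cof_retract : ∀ {X Y X' Y' : C} {f : X ⟶ Y} {g : X' ⟶ Y'}, IsRetractOf f g → Cof g → Cof f
  Fib_retract : ∀ {X Y X' Y' : C} {f : X ⟶ Y} {g : X' ⟶ Y'}, IsRetractOf f g → Fib g → Fib f
  lifting_acof_fib : ∀ {A B X Y : C} (i : A ⟶ B) (p : X ⟶ Y),
    Cof i → W i → Fib p → HasLiftingProperty i p
  lifting_cof_afib : ∀ {A B X Y : C} (i : A ⟶ B) (p : X ⟶ Y),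
    Cof i → Fib p → W p → HasLiftingProperty i p
  fact_acof_fib : ∀ {X Y : C} (f : X ⟶ Y),
    ∃ (Z : C) (i : X ⟶ Z) (p : Z ⟶ Y), Cof i ∧ W i ∧ Fib p ∧ i ≫ p = f
  fact_cof_afib : ∀ {X Y : C} (f : X ⟶ Y),
    ∃ (Z : C) (i : X ⟶ Z) (p : Z ⟶ Y), Cof i ∧ Fib p ∧ W p ∧ i ≫ p = f

/-- An object is cofibrant if the map from an initial object is a cofibration. -/
def Cofibrant {C : Type u} [Category.{v} C] [HasInitial C] (M : ModelStructure C) (X : C) :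
    Prop := M.Cof (initial.to X)

/-- An object is fibrant if the map to a terminal object is a fibration. -/
def Fibrant {C : Type u} [Category.{v} C] [HasTerminal C] (M : ModelStructure C) (X : C) :
    Prop := M.Fib (terminal.from X)

/-- A category with a wide subcategory of weak equivalences (a relative category
whose weak equivalences form a wide subcategory). -/
structure RelCatStruct (R : Type u) [Category.{v} R] where
  W : MorphismProperty R
  W_id : ∀ X : R, W (𝟙 X)
  W_comp : ∀ {X Y Z : R} (f : X ⟶ Y) (g : Y ⟶ Z), W f → W g → W (f ≫ g)

/-- The underlying relative category of a model structure. -/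
def ModelStructure.relcat {C : Type u} [Category.{v} C] (M : ModelStructure C) :
    RelCatStruct C :=
  ⟨M.W, M.W_id, M.W_comp⟩

/-- A Quillen adjunction between model categories: an adjunction `F ⊣ G` such that
`F` preserves cofibrations and acyclic cofibrations. -/
structure QuillenAdjunction {C : Type u} {D : Type u} [Category.{v} C] [Category.{v} D]
    (MC : ModelStructure C) (MD : ModelStructure D) where
  F : C ⥤ D
  G : D ⥤ C
  adj : F ⊣ G
  F_cof : ∀ {X Y : C} (f : X ⟶ Y), MC.Cof f → MD.Cof (F.map f)
  F_acof : ∀ {X Y : C} (f : X ⟶ Y), MC.Cof f → MC.W f → MD.W (F.map f)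

/-- Transporting a component of a natural transformation along an equality of objects. -/
lemma natTrans_app_congr {J E : Type u} [Category.{v} J] [Category.{v} E]
    {F G : J ⥤ E} (η : F ⟶ G) {p q : J} (e : p = q) :
    η.app p = eqToHom (by rw [e]) ≫ η.app q ≫ eqToHom (by rw [e]) := by
  subst e; simp

section ModelDiagrams

/-- A model diagram: a category equipped with three wide subcategories `W`, `C`, `F`
such that `W` satisfies the two-out-of-three axiom. -/
structure ModelDiag (I : Type u) [Category.{v} I] where
  W : MorphismProperty I
  C : MorphismProperty I
  F : MorphismProperty I
  W_id : ∀ X : I, W (𝟙 X)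
  C_id : ∀ X : I, C (𝟙 X)
  F_id : ∀ X : I, F (𝟙 X)
  W_comp : ∀ {X Y Z : I} (f : X ⟶ Y) (g : Y ⟶ Z), W f → W g → W (f ≫ g)
  C_comp : ∀ {X Y Z : I} (f : X ⟶ Y) (g : Y ⟶ Z), C f → C g → C (f ≫ g)
  F_comp : ∀ {X Y Z : I} (f : X ⟶ Y) (g : Y ⟶ Z), F f → F g → F (f ≫ g)
  W_of_precomp : ∀ {X Y Z : I} (f : X ⟶ Y) (g : Y ⟶ Z), W f → W (f ≫ g) → W g
  W_of_postcomp : ∀ {X Y Z : I} (f : X ⟶ Y) (g : Y ⟶ Z), W g → W (f ≫ g) → W f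

/-- A model category is a model diagram via its weak equivalences, cofibrations and
fibrations. -/
def ModelStructure.diag {C : Type u} [Category.{v} C] (M : ModelStructure C) :
    ModelDiag C where
  W := M.W
  C := M.Cof
  F := M.Fib
  W_id := M.W_id
  C_id := M.Cof_id
  F_id := M.Fib_id
  W_comp := M.W_comp
  C_comp := M.Cof_comp
  F_comp := M.Fib_comp
  W_of_precomp := M.W_of_precomp
  W_of_postcomp := M.W_of_postcomp

variable {I : Type u} {J : Type u} {E : Type u}
  [Category.{v} I] [Category.{v} J] [Category.{v} E]

/-- A morphism of model diagrams: a functor preserving each of the three wide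
subcategories. -/
structure MDHom (MI : ModelDiag I) (ME : ModelDiag E) where
  func : I ⥤ E
  map_W : ∀ {X Y : I} (f : X ⟶ Y), MI.W f → ME.W (func.map f)
  map_C : ∀ {X Y : I} (f : X ⟶ Y), MI.C f → ME.C (func.map f)
  map_F : ∀ {X Y : I} (f : X ⟶ Y), MI.F f → ME.F (func.map f)

/-- Composition of morphisms of model diagrams. -/
def MDHom.comp {MI : ModelDiag I} {MJ : ModelDiag J} {ME : ModelDiag E}
    (α : MDHom MI MJ) (β : MDHom MJ ME) : MDHom MI ME where
  func := α.func ⋙ β.func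
  map_W _ hf := β.map_W _ (α.map_W _ hf)
  map_C _ hf := β.map_C _ (α.map_C _ hf)
  map_F _ hf := β.map_F _ (α.map_F _ hf)

/-- The identity morphism of model diagrams. -/
def MDHom.id (MI : ModelDiag I) : MDHom MI MI where
  func := Functor.id I
  map_W _ hf := hf
  map_C _ hf := hf
  map_F _ hf := hf

/-- A morphism of doubly-pointed model diagrams: a morphism of model diagrams
preserving the two chosen objects. -/
structure PtdMDHom (MI : ModelDiag I) (sI tI : I) (ME : ModelDiag E) (sE tE : E)
    extends MDHom MI ME where
  hs : func.obj sI = sE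
  ht : func.obj tI = tE

/-- Composition of morphisms of doubly-pointed model diagrams. -/
def PtdMDHom.comp {MI : ModelDiag I} {sI tI : I} {MJ : ModelDiag J} {sJ tJ : J}
    {ME : ModelDiag E} {sE tE : E} (α : PtdMDHom MI sI tI MJ sJ tJ)
    (β : PtdMDHom MJ sJ tJ ME sE tE) : PtdMDHom MI sI tI ME sE tE where
  toMDHom := α.toMDHom.comp β.toMDHom
  hs := by
    show β.func.obj (α.func.obj sI) = sE
    rw [α.hs, β.hs]
  ht := by
    show β.func.obj (α.func.obj tI) = tE
    rw [α.ht, β.ht]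

/-- The identity as a morphism of doubly-pointed model diagrams. -/
def PtdMDHom.ptdId (MI : ModelDiag I) (sI tI : I) : PtdMDHom MI sI tI MI sI tI where
  toMDHom := MDHom.id MI
  hs := rfl
  ht := rfl

/-- The category `Fun_{**}(I,E)^W`: objects are the morphisms of doubly-pointed model
diagrams `I → E`; morphisms are the natural transformations all of whose components lie
in `W_E` and whose components at `s` and `t` are identities. -/
def FunPt (MI : ModelDiag I) (sI tI : I) (ME : ModelDiag E) (sE tE : E) : Type (max u v) :=
  PtdMDHom MI sI tI ME sE tE

instance {MI : ModelDiag I} {sI tI : I} {ME : ModelDiag E} {sE tE : E} :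
    Category.{max u v} (FunPt MI sI tI ME sE tE) where
  Hom X Y := { η : X.func ⟶ Y.func // (∀ i : I, ME.W (η.app i)) ∧
    η.app sI = eqToHom (X.hs.trans Y.hs.symm) ∧
    η.app tI = eqToHom (X.ht.trans Y.ht.symm) }
  id X := ⟨𝟙 X.func, fun _ => ME.W_id _, by simp, by simp⟩
  comp {X Y Z} η θ := ⟨η.1 ≫ θ.1, fun i => ME.W_comp _ _ (η.2.1 i) (θ.2.1 i),
    by rw [NatTrans.comp_app, η.2.2.1, θ.2.2.1, eqToHom_trans],
    by rw [NatTrans.comp_app, η.2.2.2, θ.2.2.2, eqToHom_trans]⟩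
  id_comp _ := by apply Subtype.ext; simp
  comp_id _ := by apply Subtype.ext; simp
  assoc _ _ _ := by apply Subtype.ext; simp

/-- Restriction `Fun_{**}(J,E)^W ⥤ Fun_{**}(I,E)^W` along a morphism of doubly-pointed
model diagrams `φ : I → J`. -/
def restrict {MI : ModelDiag I} {sI tI : I} {MJ : ModelDiag J} {sJ tJ : J}
    (φ : PtdMDHom MI sI tI MJ sJ tJ) (ME : ModelDiag E) (sE tE : E) :
    FunPt MJ sJ tJ ME sE tE ⥤ FunPt MI sI tI ME sE tE where
  obj X :=
    { func := φ.func ⋙ X.func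
      map_W := fun f hf => X.map_W _ (φ.map_W f hf)
      map_C := fun f hf => X.map_C _ (φ.map_C f hf)
      map_F := fun f hf => X.map_F _ (φ.map_F f hf)
      hs := by show X.func.obj (φ.func.obj sI) = sE; rw [φ.hs, X.hs]
      ht := by show X.func.obj (φ.func.obj tI) = tE; rw [φ.ht, X.ht] }
  map {X Y} η := ⟨CategoryTheory.Functor.whiskerLeft φ.func η.1, fun i => η.2.1 _,
    by
      show η.1.app (φ.func.obj sI) = _
      rw [natTrans_app_congr η.1 φ.hs, η.2.2.1, eqToHom_trans, eqToHom_trans],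
    by
      show η.1.app (φ.func.obj tI) = _
      rw [natTrans_app_congr η.1 φ.ht, η.2.2.2, eqToHom_trans, eqToHom_trans]⟩
  map_id _ := rfl
  map_comp _ _ := rfl

end ModelDiagrams

/-- An (elementary) doubly-pointed natural weak equivalence between two endomorphisms of
a doubly-pointed model diagram: a natural transformation all of whose components lie in
`W` and whose components at `s` and `t` are identities. -/
def PtdNTrel {I : Type u} [Category.{v} I] (MI : ModelDiag I) (sI tI : I)
    (α β : PtdMDHom MI sI tI MI sI tI) : Prop :=
  ∃ γ : α.func ⟶ β.func, (∀ i : I, MI.W (γ.app i)) ∧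
    γ.app sI = eqToHom (α.hs.trans β.hs.symm) ∧
    γ.app tI = eqToHom (α.ht.trans β.ht.symm)

/-- Simplicially homotopic maps remain so after postcomposition. -/
lemma Htpy.comp_right {X Y Z : SSet.{w}} {f g : X ⟶ Y} (h : Htpy f g) (k : Y ⟶ Z) :
    Htpy (f ≫ k) (g ≫ k) := by
  induction h with
  | rel _ _ h =>
    obtain ⟨H, rfl, rfl⟩ := h
    exact .rel _ _ ⟨H ≫ k, by simp, by simp⟩
  | refl _ => exact .refl _
  | symm _ _ _ ih => exact .symm _ _ ih
  | trans _ _ _ _ _ ih₁ ih₂ => exact .trans _ _ _ ih₁ ih₂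

/-- Simplicially homotopic maps remain so after precomposition. -/
lemma Htpy.comp_left {X Y Z : SSet.{w}} {f g : Y ⟶ Z} (h : Htpy f g) (k : X ⟶ Y) :
    Htpy (k ≫ f) (k ≫ g) := by
  induction h with
  | rel _ _ h =>
    obtain ⟨H, rfl, rfl⟩ := h
    have comp_lift (i : Fin 2) : k ≫ prod.lift (𝟙 Y) (constVertex Y i) =
        prod.lift (𝟙 X) (constVertex X i) ≫ prod.map k (𝟙 Δ[1]) := by
      ext1
      · simp only [Category.assoc, prod.lift_fst, prod.lift_fst_assoc, prod.map_fst,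
          Category.comp_id, Category.id_comp]
      · simp only [Category.assoc, prod.lift_snd, prod.map_snd, Category.comp_id]
        rfl
    refine .rel _ _ ⟨prod.map k (𝟙 _) ≫ H, ?_, ?_⟩ <;>
      rw [← Category.assoc, ← comp_lift, Category.assoc]
  | refl _ => exact .refl _
  | symm _ _ _ ih => exact .symm _ _ ih
  | trans _ _ _ _ _ ih₁ ih₂ => exact .trans _ _ _ ih₁ ih₂

/-- A simplicial homotopy equivalence is a weak homotopy equivalence. -/
lemma IsWeakHomotopyEquiv.of_htpy_inverse {X Y : SSet.{w}} {f : X ⟶ Y} {g : Y ⟶ X}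
    (hfg : Htpy (f ≫ g) (𝟙 X)) (hgf : Htpy (g ≫ f) (𝟙 Y)) : IsWeakHomotopyEquiv f := by
  intro K _
  refine ⟨fun k => ⟨g ≫ k, ?_⟩, fun h h' H => ?_⟩
  · simpa using hfg.comp_right k
  · have cancel (l : Y ⟶ K) : Htpy (g ≫ f ≫ l) l := by simpa using hgf.comp_right l
    exact .trans _ _ _ (.symm _ _ (cancel h)) (.trans _ _ _ (H.comp_left g) (cancel h'))

section Nerve

variable {C : Type u} {D : Type u} [Category.{v} C] [Category.{v} D]

/-- The simplex of `nerve D` swept out along a natural transformation by a simplex of the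
cylinder `nerve C ⨯ Δ[1]`. -/
def nerveHomotopySimplex {F G : C ⥤ D} (η : F ⟶ G) {m : SimplexCategoryᵒᵖ}
    (x : (nerve C).obj m) (a : (Δ[1] : SSet.{max u v}).obj m) : (nerve D).obj m :=
  Functor.prod' (show ComposableArrows C _ from x)
    ((SSet.stdSimplex.objEquiv a).toOrderHom.monotone.functor ⋙ ComposableArrows.mk₁ η) ⋙
      evaluationUncurried C D

/-- The simplicial homotopy on nerves induced by a natural transformation. -/
noncomputable def nerveHomotopy {F G : C ⥤ D} (η : F ⟶ G) : nerve C ⨯ Δ[1] ⟶ nerve D where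
  app m := TypeCat.ofHom fun z => nerveHomotopySimplex η
    ((prod.fst : nerve C ⨯ Δ[1] ⟶ _).app m z) ((prod.snd : nerve C ⨯ Δ[1] ⟶ _).app m z)
  naturality m n f := by
    ext z
    have h₁ := NatTrans.naturality_apply (prod.fst : nerve C ⨯ Δ[1] ⟶ _) f z
    have h₂ := NatTrans.naturality_apply (prod.snd : nerve C ⨯ Δ[1] ⟶ _) f z
    exact congrArg₂ (nerveHomotopySimplex η) h₁ h₂

lemma lift_constVertex_nerveHomotopy {F G : C ⥤ D} (η : F ⟶ G) (i : Fin 2) :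
    prod.lift (𝟙 (nerve C)) (constVertex (nerve C) i) ≫ nerveHomotopy η =
      nerveMap ((ComposableArrows.mk₁ η).obj i) := by
  ext m x
  have h₁ : (prod.fst : nerve C ⨯ Δ[1] ⟶ _).app m
      ((prod.lift (𝟙 (nerve C)) (constVertex (nerve C) i)).app m x) = x := by
    rw [← NatTrans.comp_app_apply, prod.lift_fst]
    rfl
  have h₂ : (prod.snd : nerve C ⨯ Δ[1] ⟶ _).app m
      ((prod.lift (𝟙 (nerve C)) (constVertex (nerve C) i)).app m x) =
        (constVertex (nerve C) i).app m x := by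
    rw [← NatTrans.comp_app_apply, prod.lift_snd]
  refine (congrArg₂ (nerveHomotopySimplex η) h₁ h₂).trans ?_
  refine CategoryTheory.Functor.ext (fun _ => rfl) fun j k f => ?_
  let X : ComposableArrows C m.unop.len := x
  have h₃ : ((ComposableArrows.mk₁ η).obj i).map (X.map f) ≫
      ((ComposableArrows.mk₁ η).map (𝟙 i)).app (X.obj k) =
        ((ComposableArrows.mk₁ η).obj i).map (X.map f) := by
    rw [CategoryTheory.Functor.map_id, NatTrans.id_app, Category.comp_id]
  exact h₃.trans ((Category.id_comp _).trans (Category.comp_id _)).symm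

lemma sHomotopy_nerveMap {F G : C ⥤ D} (η : F ⟶ G) :
    SHomotopy (nerveMap F) (nerveMap G) :=
  ⟨nerveHomotopy η, lift_constVertex_nerveHomotopy η 0, lift_constVertex_nerveHomotopy η 1⟩

end Nerve

section Restriction

variable {I : Type u} {E : Type u} [Category.{v} I] [Category.{v} E]
  {MI : ModelDiag I} {sI tI : I}

/-- Restriction is natural with respect to doubly-pointed natural weak equivalences. -/
def restrictNatTrans {α β : PtdMDHom MI sI tI MI sI tI} (γ : α.func ⟶ β.func)
    (hW : ∀ i : I, MI.W (γ.app i))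
    (hs : γ.app sI = eqToHom (α.hs.trans β.hs.symm))
    (ht : γ.app tI = eqToHom (α.ht.trans β.ht.symm))
    (ME : ModelDiag E) (sE tE : E) : restrict α ME sE tE ⟶ restrict β ME sE tE where
  app X := ⟨Functor.whiskerRight γ X.func, fun i => X.map_W _ (hW i),
    by simp [hs, eqToHom_map]; rfl, by simp [ht, eqToHom_map]; rfl⟩
  naturality X Y η := by
    apply Subtype.ext
    ext i
    exact (η.1.naturality (γ.app i)).symm

lemma htpy_nerveMap_restrict {α β : PtdMDHom MI sI tI MI sI tI}
    (h : Relation.EqvGen (PtdNTrel MI sI tI) α β) (ME : ModelDiag E) (sE tE : E) :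
    Htpy (nerveMap (restrict α ME sE tE)) (nerveMap (restrict β ME sE tE)) := by
  induction h with
  | rel _ _ h =>
    obtain ⟨γ, hW, hs, ht⟩ := h
    exact .rel _ _ (sHomotopy_nerveMap (restrictNatTrans γ hW hs ht ME sE tE))
  | refl _ => exact .refl _
  | symm _ _ _ ih => exact .symm _ _ ih
  | trans _ _ _ _ _ ih₁ ih₂ => exact .trans _ _ _ ih₁ ih₂

end Restriction

/-- let `φ : I → J` be a morphism of doubly-pointed model diagrams admitting
a section `ψ : J → I` (`φ ∘ ψ = id_J`), such that `id_I` and `ψ ∘ φ` are connected by a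
finite zigzag of doubly-pointed natural weak equivalences.  Then for every doubly-pointed
model diagram `E`, the restriction functor `φ* : Fun_{**}(J,E)^W → Fun_{**}(I,E)^W`
induces a simplicial homotopy equivalence on nerves, with homotopy inverse induced by
`ψ*`; in particular this map of nerves is a weak homotopy equivalence. -/
theorem statement9
    {I : Type u} {J : Type u} [Category.{v} I] [Category.{v} J]
    (MI : ModelDiag I) (sI tI : I) (MJ : ModelDiag J) (sJ tJ : J)
    (φ : PtdMDHom MI sI tI MJ sJ tJ) (ψ : PtdMDHom MJ sJ tJ MI sI tI)
    (hsec : ψ.comp φ = PtdMDHom.ptdId MJ sJ tJ)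
    (hzig : Relation.EqvGen (PtdNTrel MI sI tI)
      (PtdMDHom.ptdId MI sI tI) (φ.comp ψ)) :
    ∀ (E : Type u) [Category.{v} E] (ME : ModelDiag E) (sE tE : E),
      Htpy (nerveMap (restrict φ ME sE tE) ≫ nerveMap (restrict ψ ME sE tE))
        (𝟙 (nerve (FunPt MJ sJ tJ ME sE tE))) ∧
      Htpy (nerveMap (restrict ψ ME sE tE) ≫ nerveMap (restrict φ ME sE tE))
        (𝟙 (nerve (FunPt MI sI tI ME sE tE))) ∧
      IsWeakHomotopyEquiv (nerveMap (restrict φ ME sE tE)) := by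
  intro E _ ME sE tE
  have hJ : nerveMap (restrict φ ME sE tE) ≫ nerveMap (restrict ψ ME sE tE) =
      𝟙 (nerve (FunPt MJ sJ tJ ME sE tE)) := by
    change nerveMap (restrict (ψ.comp φ) ME sE tE) = _
    rw [hsec]
    rfl
  have hI : Htpy (nerveMap (restrict ψ ME sE tE) ≫ nerveMap (restrict φ ME sE tE))
      (𝟙 (nerve (FunPt MI sI tI ME sE tE))) :=
    .symm _ _ (htpy_nerveMap_restrict hzig ME sE tE)
  have hJ' : Htpy (nerveMap (restrict φ ME sE tE) ≫ nerveMap (restrict ψ ME sE tE)) (𝟙 _) := by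
    rw [hJ]
    exact .refl _
  exact ⟨hJ', hI, .of_htpy_inverse hJ' hI⟩

end Paper
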